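/- arXiv:1210.6181 — 4 statements merged into one kernel-verified Lean document; each statement's English description precedes it below -/
import Mathlib

section
/- Let W ∈ ℂ[x₁,…,x_t] be a quasi-homogeneous polynomial: there exist positive integers d, k₁,…,k_t such that W(λ^{k₁}x₁,…,λ^{k_t}x_t) = λ^d·W(x₁,…,x_t) for all λ ∈ ℂ. Assume W is nondegenerate, i.e. (1) the fractional degrees qᵢ = kᵢ/d are uniquely determined by W (any other positive integers d′, k′₁,…,k′_t satisfying the same quasi-homogeneity identity have k′ᵢ/d′ = kᵢ/d for all i), and (2) the origin is the only common zero of the partial derivatives ∂W/∂x₁,…,∂W/∂x_t (isolated singularity at the origin). Then the group H = {(α₁,…,α_t) ∈ (ℂ*)^t : W(α₁x₁,…,α_tx_t) = W(x₁,…,x_t) as polynomials} of diagonal symmetries of W is finite. -/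
open MvPolynomial

section DiagonalRescaling

variable {σ R : Type*} [Fintype σ] [CommSemiring R]

theorem MvPolynomial.bind₁_C_mul_X_monomial (a : σ → R) (s : σ →₀ ℕ) (r : R) :
    bind₁ (fun i => C (a i) * X i) (monomial s r) = monomial s ((∏ i, a i ^ s i) * r) := by
  classical
  rw [bind₁_monomial, monomial_eq (a := _ * r), Finsupp.prod_fintype _ _ (by simp),
    Finset.prod_subset (Finset.subset_univ s.support)
      (f := fun i => (C (a i) * X i : MvPolynomial σ R) ^ s i) (by simp +contextual)]
  simp only [mul_pow, Finset.prod_mul_distrib, map_mul, map_prod, map_pow]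
  ring

theorem MvPolynomial.coeff_bind₁_C_mul_X (a : σ → R) (p : MvPolynomial σ R) (m : σ →₀ ℕ) :
    coeff m (bind₁ (fun i => C (a i) * X i) p) = (∏ i, a i ^ m i) * coeff m p := by
  classical
  induction p using MvPolynomial.induction_on' with
  | monomial s r =>
    rw [bind₁_C_mul_X_monomial, coeff_monomial, coeff_monomial]
    split_ifs with h
    · rw [h]
    · rw [mul_zero]
  | add p q hp hq => rw [map_add, coeff_add, hp, hq, coeff_add, mul_add]

end DiagonalRescaling

theorem MvPolynomial.bind₁_C_mul_X_eq_C_mul_iff {σ R : Type*} [Fintype σ] [CommRing R]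
    [IsDomain R] (a : σ → R) (r : R) (p : MvPolynomial σ R) :
    bind₁ (fun i => C (a i) * X i) p = C r * p ↔ ∀ m ∈ p.support, ∏ i, a i ^ m i = r := by
  simp only [MvPolynomial.ext_iff, coeff_bind₁_C_mul_X, coeff_C_mul, mem_support_iff]
  refine forall_congr' fun m => ?_
  by_cases h : coeff m p = 0 <;> simp [h]

theorem MvPolynomial.bind₁_C_pow_mul_X_eq_iff {σ : Type*} [Fintype σ] (k : σ → ℕ) (d : ℕ)
    (W : MvPolynomial σ ℂ) :
    (∀ c : ℂ, bind₁ (fun i => C (c ^ k i) * X i) W = C (c ^ d) * W) ↔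
      ∀ m ∈ W.support, ∑ i, k i * m i = d := by
  simp only [bind₁_C_mul_X_eq_C_mul_iff, ← pow_mul, Finset.prod_pow_eq_pow_sum]
  refine ⟨fun h m hm => ?_, fun h c m hm => by rw [h m hm]⟩
  have h2 := h 2 m hm
  exact Nat.pow_right_injective le_rfl (by exact_mod_cast h2)

/-- A family of rationals has a common positive denominator. -/
theorem exists_pos_mul_eq_intCast {ι : Type*} [Fintype ι] (f : ι → ℚ) :
    ∃ n : ℕ, 0 < n ∧ ∃ z : ι → ℤ, ∀ i, (n : ℚ) * f i = z i := by
  classical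
  refine ⟨∏ i, (f i).den, Finset.prod_pos fun i _ => (f i).den_pos,
    fun i => (∏ j ∈ Finset.univ.erase i, ((f j).den : ℤ)) * (f i).num, fun i => ?_⟩
  rw [← Finset.prod_erase_mul _ _ (Finset.mem_univ i)]
  push_cast
  rw [mul_assoc, mul_comm ((f i).den : ℚ), Rat.mul_den_eq_num]

/-- If positive weights `k` of degree `d` on a set `S` of exponents are unique up to scaling,
then `S` spans the whole rational vector space. -/
theorem span_eq_top_of_unique_weights {ι : Type*} [Fintype ι] (S : Set (ι → ℕ))
    (d : ℕ) (k : ι → ℕ) (hd : 0 < d) (hk : ∀ i, 0 < k i) (hS : ∀ m ∈ S, ∑ i, k i * m i = d)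
    (huniq : ∀ (d' : ℕ) (k' : ι → ℕ), 0 < d' → (∀ i, 0 < k' i) →
      (∀ m ∈ S, ∑ i, k' i * m i = d') → ∀ i, (k' i : ℚ) / (d' : ℚ) = (k i : ℚ) / (d : ℚ)) :
    Submodule.span ℚ ((fun (m : ι → ℕ) (i : ι) => (m i : ℚ)) '' S) = ⊤ := by
  classical
  by_contra hne
  obtain ⟨f, hf0, hf⟩ := Submodule.exists_le_ker_of_lt_top _ (lt_top_iff_ne_top.2 hne)
  obtain ⟨n, hn, z, hz⟩ := exists_pos_mul_eq_intCast fun i => f (Pi.single i 1)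
  have hzS : ∀ m ∈ S, ∑ i, z i * (m i : ℤ) = 0 := by
    intro m hm
    have h0 : f (fun i => (m i : ℚ)) = 0 := hf (Submodule.subset_span ⟨m, hm, rfl⟩)
    rw [LinearMap.pi_apply_eq_sum_univ f] at h0
    have : (∑ i, (z i : ℚ) * (m i : ℚ)) = 0 := by
      rw [← mul_zero (n : ℚ), ← h0, Finset.mul_sum]
      refine Finset.sum_congr rfl fun i _ => ?_
      rw [← hz, smul_eq_mul, show (fun j => if i = j then (1 : ℚ) else 0) = Pi.single i 1 by
        ext j; simp [Pi.single_apply, eq_comm]]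
      ring
    exact_mod_cast this
  set N : ℕ := 1 + ∑ i, (z i).natAbs with hN
  have hpos : ∀ i, 0 < (N : ℤ) * k i + z i := by
    intro i
    have h1 : (z i).natAbs ≤ ∑ i, (z i).natAbs :=
      Finset.single_le_sum (f := fun i => (z i).natAbs) (fun _ _ => Nat.zero_le _)
        (Finset.mem_univ i)
    have h2 : (N : ℤ) ≤ N * k i := by exact_mod_cast Nat.le_mul_of_pos_right N (hk i)
    omega
  lift (fun i => (N : ℤ) * k i + z i) to ι → ℕ using fun i => (hpos i).le with k' hk'
  replace hk' : ∀ i, (k' i : ℤ) = N * k i + z i := fun i => congrFun hk' i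
  have hNpos : 0 < N := by omega
  have key := huniq (N * d) k' (Nat.mul_pos hNpos hd)
    (fun i => by have := hpos i; rw [← hk'] at this; exact_mod_cast this)
    (fun m hm => by
      have : (∑ i, (k' i : ℤ) * m i) = N * d := by
        simp only [hk', add_mul, Finset.sum_add_distrib, hzS m hm, ← hS m hm]
        push_cast
        rw [Finset.mul_sum, add_zero]
        exact Finset.sum_congr rfl fun i _ => mul_assoc _ _ _
      exact_mod_cast this)
  apply hf0
  refine LinearMap.pi_ext' fun i => LinearMap.ext_ring ?_
  have hi := key i
  have hki : (k' i : ℚ) = N * k i + z i := by exact_mod_cast hk' i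
  have hNq : (N : ℚ) ≠ 0 := by exact_mod_cast hNpos.ne'
  have hdq : (d : ℚ) ≠ 0 := by exact_mod_cast hd.ne'
  have hnq : (n : ℚ) ≠ 0 := by exact_mod_cast hn.ne'
  rw [hki, Nat.cast_mul, div_eq_div_iff (mul_ne_zero hNq hdq) hdq] at hi
  have hzi : (z i : ℚ) * d = 0 := by linear_combination hi
  have := hz i
  rw [(mul_eq_zero.1 hzi).resolve_right hdq] at this
  simpa using (mul_eq_zero.1 this).resolve_left hnq

/-- Every vector in the rational span of a set `S` of exponents has a positive integral multiple
whose monomial is `1` at all points where the monomials of `S` are `1`. -/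
theorem exists_pos_multiple_forall_prod_zpow_eq_one {ι G : Type*} [Fintype ι] [CommGroup G]
    (S : Set (ι → ℕ)) {x : ι → ℚ}
    (hx : x ∈ Submodule.span ℚ ((fun (m : ι → ℕ) (i : ι) => (m i : ℚ)) '' S)) :
    ∃ n : ℕ, 0 < n ∧ ∃ z : ι → ℤ, (∀ i, (n : ℚ) * x i = z i) ∧
      ∀ α : ι → G, (∀ m ∈ S, ∏ i, α i ^ m i = 1) → ∏ i, α i ^ z i = 1 := by
  induction hx using Submodule.span_induction with
  | mem x hx =>
    obtain ⟨m, hm, rfl⟩ := hx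
    exact ⟨1, one_pos, fun i => m i, by simp, fun α hα => by simpa using hα m hm⟩
  | zero => exact ⟨1, one_pos, 0, by simp, by simp⟩
  | add x y _ _ hx hy =>
    obtain ⟨n, hn, z, hz, hα⟩ := hx
    obtain ⟨n', hn', z', hz', hα'⟩ := hy
    refine ⟨n * n', Nat.mul_pos hn hn', fun i => z i * n' + z' i * n, fun i => ?_,
      fun α h => ?_⟩
    · push_cast
      rw [← hz, ← hz', Pi.add_apply]
      ring
    · simp [zpow_add, zpow_mul, Finset.prod_mul_distrib, Finset.prod_pow, hα α h, hα' α h]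
  | smul a x _ hx =>
    obtain ⟨n, hn, z, hz, hα⟩ := hx
    refine ⟨a.den * n, Nat.mul_pos a.den_pos hn, fun i => z i * a.num, fun i => ?_,
      fun α h => ?_⟩
    · push_cast
      rw [← hz, Pi.smul_apply, smul_eq_mul, ← Rat.mul_den_eq_num a]
      ring
    · simp [zpow_mul, Finset.prod_zpow, hα α h]

/-- For a nondegenerate quasi-homogeneous polynomial `W`, the group
`H` of diagonal symmetries of `W` is finite. -/
theorem stmt_0 (t : ℕ) (W : MvPolynomial (Fin t) ℂ)
    (d : ℕ) (k : Fin t → ℕ) (hd : 0 < d) (hk : ∀ i, 0 < k i)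
    (hqh : ∀ c : ℂ, bind₁ (fun i => C (c ^ k i) * X i) W = C (c ^ d) * W)
    (hnd1 : ∀ (d' : ℕ) (k' : Fin t → ℕ), 0 < d' → (∀ i, 0 < k' i) →
      (∀ c : ℂ, bind₁ (fun i => C (c ^ k' i) * X i) W = C (c ^ d') * W) →
      ∀ i, (k' i : ℚ) / (d' : ℚ) = (k i : ℚ) / (d : ℚ))
    (hnd2 : ∀ x : Fin t → ℂ, (∀ i, eval x (pderiv i W) = 0) → x = 0) :
    {α : Fin t → ℂˣ | bind₁ (fun i => C ((α i : ℂ)) * X i) W = W}.Finite := by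
  simp only [bind₁_C_pow_mul_X_eq_iff] at hqh hnd1
  set S : Set (Fin t → ℕ) := (fun m : Fin t →₀ ℕ => ⇑m) '' W.support with hS
  have hspan := span_eq_top_of_unique_weights S d k hd hk
    (by simpa [hS] using hqh) (by simpa [hS] using hnd1)
  have hroot : ∀ i : Fin t, ∃ n : ℕ, 0 < n ∧
      ∀ α : Fin t → ℂˣ, (∀ m ∈ S, ∏ j, α j ^ m j = 1) → α i ^ n = 1 := by
    intro i
    obtain ⟨n, hn, z, hz, hα⟩ := exists_pos_multiple_forall_prod_zpow_eq_one (G := ℂˣ) S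
      (x := Pi.single i 1) (hspan ▸ Submodule.mem_top)
    refine ⟨n, hn, fun α h => ?_⟩
    have hzi : z = Pi.single i (n : ℤ) := by
      ext j
      have := hz j
      rcases eq_or_ne j i with rfl | hj
      · simp only [Pi.single_eq_same, mul_one] at this ⊢
        exact_mod_cast this.symm
      · simp only [Pi.single_eq_of_ne hj, mul_zero] at this ⊢
        exact_mod_cast this.symm
    have h1 := hα α h
    rw [hzi, Finset.prod_eq_single i (fun j _ hj => by simp [Pi.single_eq_of_ne hj])
      (by simp)] at h1
    simpa using h1
  choose n hn hroot using hroot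
  refine (Set.Finite.pi' (t := fun i => {u : ℂˣ | u ^ n i = 1}) fun i => ?_).subset ?_
  · have : NeZero (n i) := ⟨(hn i).ne'⟩
    exact (inferInstance : Finite (rootsOfUnity (n i) ℂ))
  · intro α hα i
    refine hroot i α ?_
    have h1 : bind₁ (fun i => C (α i : ℂ) * X i) W = C 1 * W := by simpa using hα
    rw [bind₁_C_mul_X_eq_C_mul_iff] at h1
    rintro _ ⟨m, hm, rfl⟩
    exact Units.ext (by simpa using h1 m hm)
end

section
/- Let 0 ≤ c < 1 and let p be a real number with p ≥ 2/(1−c). Let u : ℂ → ℂ be holomorphic on the punctured unit ball B₁(0)∖{0} and suppose ∫_{B₁(0)} |u(z)|^p·|z|^{cp} dA(z) < ∞, where dA is Lebesgue area measure. Then u extends holomorphically across the origin: there exists g holomorphic on B₁(0) with g = u on B₁(0)∖{0}. -/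
open MeasureTheory

open Set Filter Topology in
/-- The mean value inequality over a circle, in terms of the lower integral. -/
lemma enorm_mul_volume_le_lintegral_circleMap {f : ℂ → ℂ} {z : ℂ} {R r : ℝ}
    (hf : DifferentiableOn ℂ f (Metric.ball z R)) (hr0 : 0 < r) (hr : r < R) :
    ‖f z‖ₑ * volume (Ioo (-Real.pi) Real.pi) ≤
      ∫⁻ θ in Ioo (-Real.pi) Real.pi, ‖f (circleMap z r θ)‖ₑ := by
  have hpi := Real.pi_pos
  have hmean : Real.circleAverage f z r = f z := by
    apply DiffContOnCl.circleAverage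
    rw [abs_of_pos hr0]
    apply DifferentiableOn.diffContOnCl
    rw [closure_ball z hr0.ne']
    exact hf.mono (Metric.closedBall_subset_ball hr)
  have hint : ((2 * Real.pi : ℝ) : ℂ) * f z =
      ∫ θ in Ioc (-Real.pi) Real.pi, f (circleMap z r θ) := by
    rw [← hmean, Real.circleAverage_eq_integral_add (-Real.pi),
      intervalIntegral.integral_comp_add_right (fun θ ↦ f (circleMap z r θ)),
      ← intervalIntegral.integral_of_le (by linarith), Complex.real_smul, ← mul_assoc,
      ← Complex.ofReal_mul, mul_inv_cancel₀ (by positivity)]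
    norm_num
    congr 1
    ring
  rw [restrict_Ioo_eq_restrict_Ioc]
  calc ‖f z‖ₑ * volume (Ioo (-Real.pi) Real.pi)
      = ‖((2 * Real.pi : ℝ) : ℂ) * f z‖ₑ := by
        rw [enorm_mul, Real.volume_Ioo, mul_comm, ← ofReal_norm ((2 * Real.pi : ℝ) : ℂ),
          Complex.norm_real, Real.norm_of_nonneg (by positivity)]
        congr 2
        ring
    _ ≤ _ := by
        rw [hint]
        exact enorm_integral_le_lintegral_enorm _

open Set Filter Topology Classical in
/-- The mean value inequality over a disc, in terms of the lower integral. -/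
lemma enorm_mul_volume_ball_le_lintegral {f : ℂ → ℂ} {z : ℂ} {R : ℝ}
    (hf : DifferentiableOn ℂ f (Metric.ball z R)) :
    ‖f z‖ₑ * volume (Metric.ball z R) ≤ ∫⁻ w in Metric.ball z R, ‖f w‖ₑ := by
  set F : ℂ → ENNReal := (Metric.ball z R).indicator fun w ↦ ‖f w‖ₑ
  have hF : Measurable F := by
    have h : Measurable ((Metric.ball z R).piecewise f 0) :=
      hf.continuousOn.measurable_piecewise continuousOn_const Metric.isOpen_ball.measurableSet
    convert h.enorm using 1
    ext w
    by_cases hw : w ∈ Metric.ball z R <;> simp [F, hw]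
  set G : ℂ → ENNReal := (Metric.ball z R).indicator fun _ ↦ ‖f z‖ₑ
  have hG : ∫⁻ w, G w = ‖f z‖ₑ * volume (Metric.ball z R) := by
    simp [G, lintegral_indicator Metric.isOpen_ball.measurableSet]
  have polar (H : ℂ → ENNReal) (hH : Measurable H) : ∫⁻ w, H w =
      ∫⁻ r in Ioi (0 : ℝ), ∫⁻ θ in Ioo (-Real.pi) Real.pi,
        ENNReal.ofReal r * H (circleMap z r θ) := by
    rw [← lintegral_add_left_eq_self H z, ← Complex.lintegral_comp_polarCoord_symm,
      polarCoord_target, Measure.volume_eq_prod, ← Measure.prod_restrict, lintegral_prod]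
    · simp [circleMap, Complex.exp_mul_I]
    · simp only [Complex.polarCoord_symm_apply, smul_eq_mul]
      fun_prop
  rw [← hG, ← lintegral_indicator Metric.isOpen_ball.measurableSet, polar F hF,
    polar G (measurable_const.indicator Metric.isOpen_ball.measurableSet)]
  refine setLIntegral_mono' measurableSet_Ioi fun r (hr0 : 0 < r) ↦ ?_
  rw [lintegral_const_mul' _ _ ENNReal.ofReal_ne_top,
    lintegral_const_mul' _ _ ENNReal.ofReal_ne_top]
  refine mul_le_mul_right ?_ _
  rcases lt_or_ge r R with hr | hr
  · have hmem θ : circleMap z r θ ∈ Metric.ball z R := by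
      simpa [Metric.mem_ball, dist_eq_norm, abs_of_pos hr0] using hr
    simpa [F, G, hmem, -Real.volume_Ioo] using enorm_mul_volume_le_lintegral_circleMap hf hr0 hr
  · have hmem θ : circleMap z r θ ∉ Metric.ball z R := by
      simpa [Metric.mem_ball, dist_eq_norm, abs_of_pos hr0] using hr
    simp [G, hmem]

open Set Filter Topology in
/-- The mean value inequality over a disc for the `p`-th power of a holomorphic function. -/
lemma enorm_rpow_mul_volume_ball_le_lintegral {f : ℂ → ℂ} {z : ℂ} {R p : ℝ} (hp : 1 ≤ p)
    (hR : 0 < R) (hf : DifferentiableOn ℂ f (Metric.ball z R)) :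
    ‖f z‖ₑ ^ p * volume (Metric.ball z R) ≤ ∫⁻ w in Metric.ball z R, ‖f w‖ₑ ^ p := by
  have hp0 : 0 < p := by linarith
  have h := eLpNorm'_le_eLpNorm'_mul_rpow_measure_univ (μ := volume.restrict (Metric.ball z R))
    one_pos hp (hf.continuousOn.aestronglyMeasurable Metric.isOpen_ball.measurableSet)
  have h1 := (enorm_mul_volume_ball_le_lintegral hf).trans
    (by simpa [eLpNorm', -Complex.volume_ball] using h)
  have hV0 : volume (Metric.ball z R) ≠ 0 := (Metric.measure_ball_pos _ _ hR).ne'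
  have hVt : volume (Metric.ball z R) ≠ ⊤ := measure_ball_lt_top.ne
  generalize volume (Metric.ball z R) = V at *
  have h2 := ENNReal.rpow_le_rpow h1 hp0.le
  rw [ENNReal.mul_rpow_of_nonneg _ _ hp0.le, ENNReal.mul_rpow_of_nonneg _ _ hp0.le,
    ← ENNReal.rpow_mul, ← ENNReal.rpow_mul, inv_mul_cancel₀ hp0.ne', ENNReal.rpow_one,
    sub_mul, inv_mul_cancel₀ hp0.ne', one_mul] at h2
  have hV : V ^ p = V * V ^ (p - 1) := by
    nth_rw 2 [← ENNReal.rpow_one V]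
    rw [← ENNReal.rpow_add _ _ hV0 hVt, add_sub_cancel]
  rw [hV, ← mul_assoc] at h2
  refine (ENNReal.mul_le_mul_iff_left ?_ ?_).1 h2
  · simp [ENNReal.rpow_eq_zero_iff, hV0, hVt]
  · simp [ENNReal.rpow_eq_top_iff, hV0, hVt]

open Set Filter Topology in
/-- A weighted `L^p` bound on the disc `B(z, |z|/2)` controls `|z| |u(z)|`. -/
lemma ofReal_rpow_mul_pi_le_setLIntegral {c p : ℝ} (hc0 : 0 ≤ c) (hc1 : c < 1)
    (hp : 2 / (1 - c) ≤ p) {u : ℂ → ℂ}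
    (hu : DifferentiableOn ℂ u (Metric.ball (0 : ℂ) 1 \ {0})) {z : ℂ} (hz0 : z ≠ 0)
    (hz : ‖z‖ < 1 / 2) :
    ENNReal.ofReal ((‖z‖ / 2 * ‖u z‖) ^ p * Real.pi) ≤
      ∫⁻ w in Metric.ball z (‖z‖ / 2), ENNReal.ofReal (‖u w‖ ^ p * ‖w‖ ^ (c * p)) := by
  have hp' : 2 + c * p ≤ p := by
    rw [div_le_iff₀ (by linarith)] at hp
    linarith
  have hp2 : 2 ≤ p := by
    refine le_trans ?_ hp
    rw [le_div_iff₀ (by linarith)]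
    linarith
  have hp0 : 0 ≤ p := by linarith
  have hcp : 0 ≤ c * p := mul_nonneg hc0 hp0
  have hs0 : 0 < ‖z‖ / 2 := by positivity
  have hlow {w : ℂ} (hw : w ∈ Metric.ball z (‖z‖ / 2)) : ‖z‖ / 2 ≤ ‖w‖ := by
    rw [mem_ball_iff_norm'] at hw
    linarith [norm_sub_norm_le z w]
  have hsub : Metric.ball z (‖z‖ / 2) ⊆ Metric.ball (0 : ℂ) 1 \ {0} := by
    intro w hw
    refine ⟨?_, fun h ↦ ?_⟩
    · rw [mem_ball_iff_norm] at hw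
      rw [mem_ball_zero_iff]
      linarith [norm_sub_norm_le w z]
    · have := hlow hw
      rw [mem_singleton_iff.1 h, norm_zero] at this
      linarith
  have hmean := enorm_rpow_mul_volume_ball_le_lintegral (by linarith : 1 ≤ p) hs0 (hu.mono hsub)
  have henorm (w : ℂ) : ‖u w‖ₑ ^ p = ENNReal.ofReal (‖u w‖ ^ p) := by
    rw [← ofReal_norm, ENNReal.ofReal_rpow_of_nonneg (norm_nonneg _) hp0]
  have hvol : volume (Metric.ball z (‖z‖ / 2)) = ENNReal.ofReal ((‖z‖ / 2) ^ 2 * Real.pi) := by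
    rw [Complex.volume_ball, ENNReal.ofReal_mul (by positivity), ENNReal.ofReal_pow hs0.le,
      ← NNReal.coe_real_pi, ENNReal.ofReal_coe_nnreal]
  calc ENNReal.ofReal ((‖z‖ / 2 * ‖u z‖) ^ p * Real.pi)
      ≤ ENNReal.ofReal ((‖z‖ / 2) ^ (c * p)) *
          (‖u z‖ₑ ^ p * volume (Metric.ball z (‖z‖ / 2))) := by
        rw [henorm, hvol, ← ENNReal.ofReal_mul (by positivity),
          ← ENNReal.ofReal_mul (by positivity)]
        apply ENNReal.ofReal_le_ofReal
        have hle : (‖z‖ / 2) ^ p ≤ (‖z‖ / 2) ^ 2 * (‖z‖ / 2) ^ (c * p) := by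
          rw [← Real.rpow_natCast, ← Real.rpow_add hs0]
          exact Real.rpow_le_rpow_of_exponent_ge hs0 (by linarith) (mod_cast hp')
        rw [Real.mul_rpow hs0.le (norm_nonneg _)]
        calc (‖z‖ / 2) ^ p * ‖u z‖ ^ p * Real.pi
            ≤ (‖z‖ / 2) ^ 2 * (‖z‖ / 2) ^ (c * p) * ‖u z‖ ^ p * Real.pi := by gcongr
          _ = _ := by ring
    _ ≤ ENNReal.ofReal ((‖z‖ / 2) ^ (c * p)) *
          ∫⁻ w in Metric.ball z (‖z‖ / 2), ‖u w‖ₑ ^ p := by gcongr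
    _ = ∫⁻ w in Metric.ball z (‖z‖ / 2), ENNReal.ofReal ((‖z‖ / 2) ^ (c * p)) * ‖u w‖ₑ ^ p :=
        (lintegral_const_mul' _ _ ENNReal.ofReal_ne_top).symm
    _ ≤ _ := by
        refine setLIntegral_mono' Metric.isOpen_ball.measurableSet fun w hw ↦ ?_
        rw [henorm, ← ENNReal.ofReal_mul (by positivity), mul_comm]
        gcongr
        exact hlow hw

open Set Filter Topology in
/-- A function in the weighted `L^p` space that is holomorphic on the punctured disc is `o(1/|z|)`
at the origin. -/
lemma tendsto_norm_mul_norm_of_lintegral_lt_top {c p : ℝ} (hc0 : 0 ≤ c) (hc1 : c < 1)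
    (hp : 2 / (1 - c) ≤ p) {u : ℂ → ℂ}
    (hu : DifferentiableOn ℂ u (Metric.ball (0 : ℂ) 1 \ {0}))
    (hint : ∫⁻ z in Metric.ball (0 : ℂ) 1,
        ENNReal.ofReal (‖u z‖ ^ p * ‖z‖ ^ (c * p)) ∂volume < ⊤) :
    Tendsto (fun z ↦ ‖z‖ * ‖u z‖) (𝓝[≠] 0) (𝓝 0) := by
  have hp0 : 0 < p := lt_of_lt_of_le (div_pos two_pos (by linarith)) hp
  have hnorm : Tendsto (fun z : ℂ ↦ ‖z‖) (𝓝[≠] 0) (𝓝 0) :=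
    tendsto_norm_zero.mono_left nhdsWithin_le_nhds
  have hvol : Tendsto (volume.restrict (Metric.ball (0 : ℂ) 1) ∘
      fun z : ℂ ↦ Metric.ball z (‖z‖ / 2)) (𝓝[≠] 0) (𝓝 0) := by
    have h : Tendsto (fun z : ℂ ↦ ENNReal.ofReal (‖z‖ / 2) ^ 2 * NNReal.pi) (𝓝[≠] 0) (𝓝 0) := by
      have h1 : Tendsto (fun z : ℂ ↦ ENNReal.ofReal ((‖z‖ / 2) ^ 2 * Real.pi))
          (𝓝[≠] 0) (𝓝 0) := by
        simpa using ENNReal.tendsto_ofReal (((hnorm.div_const 2).pow 2).mul_const Real.pi)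
      refine h1.congr fun z ↦ ?_
      rw [ENNReal.ofReal_mul (by positivity), ENNReal.ofReal_pow (by positivity),
        ← NNReal.coe_real_pi, ENNReal.ofReal_coe_nnreal]
    refine tendsto_of_tendsto_of_tendsto_of_le_of_le tendsto_const_nhds h (fun _ ↦ zero_le) ?_
    intro z
    exact (Measure.restrict_apply_le _ _).trans (Complex.volume_ball _ _).le
  have hJ := tendsto_setLIntegral_zero hint.ne hvol
  have hsmall : ∀ᶠ z : ℂ in 𝓝[≠] 0, ‖z‖ < 1 / 2 := hnorm.eventually_lt_const (by norm_num)
  have hE : Tendsto (fun z : ℂ ↦ ENNReal.ofReal ((‖z‖ / 2 * ‖u z‖) ^ p * Real.pi))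
      (𝓝[≠] 0) (𝓝 0) := by
    refine tendsto_of_tendsto_of_tendsto_of_le_of_le' tendsto_const_nhds hJ
      (Eventually.of_forall fun _ ↦ zero_le) ?_
    filter_upwards [hsmall, self_mem_nhdsWithin] with z hz hz0
    rw [Measure.restrict_restrict Metric.isOpen_ball.measurableSet, inter_eq_self_of_subset_left]
    · exact ofReal_rpow_mul_pi_le_setLIntegral hc0 hc1 hp hu hz0 hz
    · apply Metric.ball_subset_ball'
      rw [dist_zero_right]
      linarith
  have hR : Tendsto (fun z : ℂ ↦ (‖z‖ / 2 * ‖u z‖) ^ p * Real.pi) (𝓝[≠] 0) (𝓝 0) := by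
    have h := (ENNReal.tendsto_toReal ENNReal.zero_ne_top).comp hE
    refine h.congr fun z ↦ ?_
    exact ENNReal.toReal_ofReal (by positivity)
  have h := ((hR.div_const Real.pi).rpow_const (p := p⁻¹)
    (Or.inr (inv_nonneg.2 hp0.le))).const_mul 2
  simp only [zero_div, Real.zero_rpow (inv_ne_zero hp0.ne'), mul_zero] at h
  refine h.congr fun z ↦ ?_
  rw [mul_div_cancel_right₀ _ Real.pi_ne_zero, Real.rpow_rpow_inv (by positivity) hp0.ne']
  ring

/-- a holomorphic function on the punctured unit disc lying in the
weighted `L^p` space with weight `|z|^{cp}`, `0 ≤ c < 1`, `p ≥ 2/(1−c)`, extends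
holomorphically across the origin. -/
theorem stmt_9 (c p : ℝ) (hc0 : 0 ≤ c) (hc1 : c < 1) (hp : 2 / (1 - c) ≤ p)
    (u : ℂ → ℂ)
    (hu : DifferentiableOn ℂ u (Metric.ball (0 : ℂ) 1 \ {0}))
    (hint : ∫⁻ z in Metric.ball (0 : ℂ) 1,
        ENNReal.ofReal (‖u z‖ ^ p * ‖z‖ ^ (c * p)) ∂volume < ⊤) :
    ∃ g : ℂ → ℂ, DifferentiableOn ℂ g (Metric.ball (0 : ℂ) 1) ∧
      Set.EqOn g u (Metric.ball (0 : ℂ) 1 \ {0}) := by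
  have hlim := tendsto_norm_mul_norm_of_lintegral_lt_top hc0 hc1 hp hu hint
  refine ⟨_, Complex.differentiableOn_update_limUnder_of_isLittleO
    (Metric.ball_mem_nhds 0 one_pos) hu ?_, fun z hz ↦ Function.update_of_ne hz.2 _ _⟩
  simp only [sub_zero]
  refine Asymptotics.IsLittleO.sub ?_ ?_
  · rw [Asymptotics.isLittleO_iff_tendsto', tendsto_zero_iff_norm_tendsto_zero]
    · refine hlim.congr fun z ↦ ?_
      simp [mul_comm]
    · filter_upwards [self_mem_nhdsWithin] with z hz h
      exact absurd (inv_eq_zero.1 h) hz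
  · rw [Asymptotics.isLittleO_const_left]
    right
    exact tendsto_norm_inv_nhdsNE_zero_atTop
end

section
/- Let f : ℂ → ℂ be continuously differentiable with support contained in the closed unit disc, and define u(z) = (1/π)·∫_{|w|<1} f(w)/(z−w) dA(w). Then u is real-Fréchet-differentiable at every z ∈ ℂ and satisfies ∂̄u(z) = f(z), i.e. ½·((Du)(z)(1) + i·(Du)(z)(i)) = f(z), where (Du)(z) is the real Fréchet derivative of u at z. -/
open MeasureTheory

/-- The Cauchy transform `u(z) = (1/π)·∫_{|w|<1} f(w)/(z−w) dA(w)`. -/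
noncomputable def cauchyTransform (f : ℂ → ℂ) (z : ℂ) : ℂ :=
  (Real.pi : ℂ)⁻¹ * ∫ w in Metric.ball (0 : ℂ) 1, f w / (z - w) ∂volume

open Set Metric Complex
open scoped Convolution

/-- The Cauchy kernel `w ↦ w⁻¹` is locally integrable on the complex plane. -/
theorem locallyIntegrable_complex_inv : LocallyIntegrable (fun w : ℂ => w⁻¹) volume := by
  rw [locallyIntegrable_iff]
  intro k hk
  obtain ⟨R, hR⟩ := hk.isBounded.subset_ball (0 : ℂ)
  refine IntegrableOn.mono_set ?_ hR
  have h : Integrable (fun w : ℂ => (Iio R).indicator (fun y : ℝ => y⁻¹) ‖w‖) volume := by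
    rw [integrable_fun_norm_addHaar volume]
    have h1 : IntegrableOn ((Iio R).indicator fun _ : ℝ => (1 : ℝ)) (Ioi 0) volume := by
      rw [IntegrableOn, integrable_indicator_iff measurableSet_Iio, IntegrableOn,
        Measure.restrict_restrict measurableSet_Iio, inter_comm, Ioi_inter_Iio]
      exact integrableOn_const (by simp)
    refine h1.congr_fun (fun y hy => ?_) measurableSet_Ioi
    have hy' : y ≠ 0 := ne_of_gt hy
    by_cases hyR : y ∈ Iio R <;> simp [hyR, hy', Complex.finrank_real_complex]
  rw [← integrable_indicator_iff measurableSet_ball]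
  refine h.mono ?_ (Filter.Eventually.of_forall fun w => ?_)
  · exact (measurable_inv.indicator measurableSet_ball).aestronglyMeasurable
  · by_cases hw : ‖w‖ < R <;> simp [indicator, hw]

section PolarCoordinates

variable {f : ℂ → ℂ}

/-- The derivative of a `C¹` function along the ray from `z` in direction `a`. -/
theorem hasDerivAt_comp_ray (hf : ContDiff ℝ 1 f) (z a : ℂ) (r : ℝ) :
    HasDerivAt (fun r : ℝ => f (z + r * a)) (fderiv ℝ f (z + r * a) a) r := by
  have h1 : HasDerivAt (fun r : ℝ => z + (r : ℂ) * a) a r := by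
    simpa using ((Complex.ofRealCLM.hasDerivAt (x := r)).mul_const a).const_add z
  exact ((hf.differentiable one_ne_zero (z + r * a)).hasFDerivAt).comp_hasDerivAt r h1

/-- The radial derivative of a compactly supported `C¹` function integrates to `-f z`. -/
theorem integral_Ioi_fderiv_ray (hf : ContDiff ℝ 1 f) (hc : HasCompactSupport f) (z : ℂ) {a : ℂ}
    (ha : a ≠ 0) : ∫ r in Ioi (0 : ℝ), fderiv ℝ f (z + r * a) a = -f z := by
  have hcd : ContDiff ℝ 1 (fun r : ℝ => f (z + r * a)) :=
    hf.comp (contDiff_const.add (Complex.ofRealCLM.contDiff.mul contDiff_const))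
  have hemb : Topology.IsClosedEmbedding (fun r : ℝ => z + (r : ℂ) * a) :=
    ((Homeomorph.addLeft z).isClosedEmbedding.comp
      (Homeomorph.mulRight₀ a ha).isClosedEmbedding).comp Complex.isometry_ofReal.isClosedEmbedding
  have hcs : HasCompactSupport (fun r : ℝ => f (z + r * a)) :=
    hc.comp_isClosedEmbedding hemb
  have h := hcs.integral_Ioi_deriv_eq hcd 0
  simp only [(hasDerivAt_comp_ray hf z a _).deriv] at h
  simpa using h

theorem hasDerivAt_comp_circle (hf : ContDiff ℝ 1 f) (z : ℂ) (r θ : ℝ) :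
    HasDerivAt (fun θ : ℝ => f (z + r * exp (θ * I)))
      (r • fderiv ℝ f (z + r * exp (θ * I)) (I * exp (θ * I))) θ := by
  have h1 : HasDerivAt (fun θ : ℝ => z + (r : ℂ) * exp (θ * I)) (r • (I * exp (θ * I))) θ := by
    have h := (((Complex.ofRealCLM.hasDerivAt (x := θ)).mul_const I).cexp.const_mul
      (r : ℂ)).const_add z
    have e : r • (I * exp (θ * I))
        = (r : ℂ) * (exp (Complex.ofRealCLM θ * I) * (Complex.ofRealCLM 1 * I)) := by
      rw [Complex.real_smul]
      simp only [Complex.ofRealCLM_apply, Complex.ofReal_one]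
      ring
    rw [e]
    exact h
  have := ((hf.differentiable one_ne_zero (z + r * exp (θ * I))).hasFDerivAt).comp_hasDerivAt θ h1
  rwa [map_smul] at this

/-- The tangential derivative of a `C¹` function integrates to zero over a circle. -/
theorem integral_fderiv_circle (hf : ContDiff ℝ 1 f) (z : ℂ) {r : ℝ} (hr : r ≠ 0) :
    ∫ θ in Ioo (-Real.pi) Real.pi,
      fderiv ℝ f (z + r * exp (θ * I)) (I * exp (θ * I)) = 0 := by
  have hf' := hf.continuous_fderiv one_ne_zero
  have hcont : Continuous fun θ : ℝ =>
      r • fderiv ℝ f (z + r * exp (θ * I)) (I * exp (θ * I)) := by fun_prop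
  have h := intervalIntegral.integral_eq_sub_of_hasDerivAt
    (fun θ _ => hasDerivAt_comp_circle hf z r θ) (hcont.intervalIntegrable (-Real.pi) Real.pi)
  have hexp : exp (((-Real.pi : ℝ) : ℂ) * I) = exp ((Real.pi : ℂ) * I) := by
    simp [Complex.exp_neg]
  rw [hexp, sub_self, intervalIntegral.integral_of_le (by linarith [Real.pi_pos]),
    integral_Ioc_eq_integral_Ioo, integral_smul] at h
  exact (smul_eq_zero.mp h).resolve_left hr

theorem integrableOn_polar_of_continuous {g : ℝ × ℝ → ℂ} (hg : Continuous g) {R : ℝ}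
    (hR : ∀ p : ℝ × ℝ, R < p.1 → g p = 0) :
    IntegrableOn g (Ioi (0 : ℝ) ×ˢ Ioo (-Real.pi) Real.pi) volume := by
  have h : IntegrableOn g (Icc (0 : ℝ) R ×ˢ Icc (-Real.pi) Real.pi) volume :=
    hg.continuousOn.integrableOn_compact (isCompact_Icc.prod isCompact_Icc)
  refine h.of_forall_sdiff_eq_zero (measurableSet_Ioi.prod measurableSet_Ioo) ?_
  rintro p ⟨⟨hp1, hp2⟩, hp⟩
  refine hR p (not_le.mp fun hle => hp ⟨⟨le_of_lt hp1, hle⟩, Ioo_subset_Icc_self hp2⟩)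

/-- The **Cauchy–Pompeiu formula** for compactly supported functions. -/
theorem integral_dbar_mul_inv (hf : ContDiff ℝ 1 f) (hc : HasCompactSupport f) (z : ℂ) :
    ∫ w, (fderiv ℝ f (z + w) 1 + I * fderiv ℝ f (z + w) I) * w⁻¹ = -(2 * Real.pi * f z) := by
  have hf' := hf.continuous_fderiv one_ne_zero
  obtain ⟨S, hS⟩ := (hc.fderiv ℝ).isCompact.isBounded.subset_closedBall (0 : ℂ)
  have hz : ∀ p : ℝ × ℝ, ‖z‖ + S < p.1 → fderiv ℝ f (z + p.1 * exp (p.2 * I)) = 0 := by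
    intro p hp
    by_contra hne
    have hmem := hS (subset_tsupport _ (Function.mem_support.mpr hne))
    simp only [mem_closedBall, dist_zero_right] at hmem
    have h1 : ‖(p.1 : ℂ) * exp (p.2 * I)‖ = |p.1| := by
      simp [Complex.norm_exp_ofReal_mul_I]
    have h2 := norm_sub_le (z + p.1 * exp (p.2 * I)) z
    rw [add_sub_cancel_left, h1] at h2
    linarith [le_abs_self p.1]
  set A : ℝ × ℝ → ℂ := fun p => fderiv ℝ f (z + p.1 * exp (p.2 * I)) (exp (p.2 * I)) with hA
  set B : ℝ × ℝ → ℂ := fun p => fderiv ℝ f (z + p.1 * exp (p.2 * I)) (I * exp (p.2 * I)) with hB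
  have hAi := integrableOn_polar_of_continuous (g := A) (R := ‖z‖ + S) (by fun_prop)
    (fun p hp => by simp [hA, hz p hp])
  have hBi := integrableOn_polar_of_continuous (g := B) (R := ‖z‖ + S) (by fun_prop)
    (fun p hp => by simp [hB, hz p hp])
  have hAint : ∫ p in Ioi (0 : ℝ) ×ˢ Ioo (-Real.pi) Real.pi, A p = -(2 * Real.pi * f z) := by
    rw [IntegrableOn, Measure.volume_eq_prod, ← Measure.prod_restrict] at hAi
    rw [Measure.volume_eq_prod, ← Measure.prod_restrict, integral_prod_symm _ hAi]
    simp only [hA, integral_Ioi_fderiv_ray hf hc z (exp_ne_zero _)]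
    simp only [integral_const, MeasurableSet.univ, measureReal_restrict_apply, univ_inter,
      Real.volume_real_Ioo_of_le (by linarith [Real.pi_pos] : -Real.pi ≤ Real.pi)]
    rw [Complex.real_smul]
    push_cast
    ring
  have hBint : ∫ p in Ioi (0 : ℝ) ×ˢ Ioo (-Real.pi) Real.pi, B p = 0 := by
    rw [Measure.volume_eq_prod] at hBi ⊢
    rw [setIntegral_prod _ hBi]
    refine setIntegral_eq_zero_of_forall_eq_zero fun r hr => ?_
    exact integral_fderiv_circle hf z (ne_of_gt hr)
  rw [← Complex.integral_comp_polarCoord_symm, polarCoord_target]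
  have hcongr : ∀ p ∈ Ioi (0 : ℝ) ×ˢ Ioo (-Real.pi) Real.pi,
      p.1 • ((fderiv ℝ f (z + Complex.polarCoord.symm p) 1
        + I * fderiv ℝ f (z + Complex.polarCoord.symm p) I) * (Complex.polarCoord.symm p)⁻¹)
      = A p + I * B p := by
    rintro ⟨r, θ⟩ ⟨hr, -⟩
    have hr' : (r : ℂ) ≠ 0 := by exact_mod_cast ne_of_gt hr
    have hpol : Complex.polarCoord.symm (r, θ) = r * exp (θ * I) := by
      rw [Complex.polarCoord_symm_apply, exp_mul_I]
      push_cast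
      rfl
    simp only [hA, hB, hpol]
    set L := fderiv ℝ f (z + r * exp (θ * I))
    have hlin : ∀ x y : ℝ, L (x + y * I) = x * L 1 + y * L I := by
      intro x y
      have : (x : ℂ) + y * I = x • (1 : ℂ) + y • I := by simp
      rw [this, map_add, map_smul, map_smul, Complex.real_smul, Complex.real_smul]
    have e1 : exp (θ * I) = (Real.cos θ : ℝ) + (Real.sin θ : ℝ) * I := by
      rw [exp_mul_I]; push_cast; rfl
    have e2 : I * exp (θ * I) = ((-Real.sin θ : ℝ) : ℂ) + (Real.cos θ : ℝ) * I := by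
      rw [e1]; push_cast; linear_combination (Complex.sin θ) * I_sq
    have e3 : (exp (θ * I))⁻¹ = (Real.cos θ : ℝ) - (Real.sin θ : ℝ) * I := by
      rw [← Complex.exp_neg, ← neg_mul, exp_mul_I]
      simp [sub_eq_add_neg]
    rw [e2, mul_inv, e3, e1, hlin, hlin, Complex.real_smul]
    field_simp
    push_cast
    linear_combination (-(Complex.sin θ) * L I) * I_sq
  rw [setIntegral_congr_fun (measurableSet_Ioi.prod measurableSet_Ioo) hcongr,
    integral_add hAi (hBi.const_mul I), hAint, integral_const_mul, hBint]
  simp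

end PolarCoordinates

theorem cauchyTransform_eq_convolution {f : ℂ → ℂ} (hf : Continuous f)
    (hsupp : Function.support f ⊆ closedBall (0 : ℂ) 1) (z : ℂ) :
    cauchyTransform f z
      = (Real.pi : ℂ)⁻¹ * (f ⋆[ContinuousLinearMap.mul ℝ ℂ] fun w : ℂ => w⁻¹) z := by
  have hsupp' : Function.support f ⊆ ball (0 : ℂ) 1 := by
    rw [← interior_closedBall (0 : ℂ) one_ne_zero]
    exact interior_maximal hsupp hf.isOpen_support
  rw [cauchyTransform, convolution_def]
  congr 1
  rw [setIntegral_eq_integral_of_forall_compl_eq_zero]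
  · simp [div_eq_mul_inv]
  · intro w hw
    have : f w = 0 := Function.notMem_support.mp fun h => hw (hsupp' h)
    simp [this]

/-- the Cauchy transform of a `C¹` function supported in the
closed unit disc solves `∂̄u = f`, where
`∂̄u(z) = ½·((Du)(z)(1) + i·(Du)(z)(i))` for the real Fréchet derivative `Du`. -/
theorem stmt_14 (f : ℂ → ℂ) (hf : ContDiff ℝ 1 f)
    (hsupp : Function.support f ⊆ Metric.closedBall (0 : ℂ) 1) :
    ∀ z : ℂ, ∃ D : ℂ →L[ℝ] ℂ, HasFDerivAt (cauchyTransform f) D z ∧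
      (1 / 2 : ℂ) * (D 1 + Complex.I * D Complex.I) = f z := by
  intro z
  have hc : HasCompactSupport f :=
    HasCompactSupport.of_support_subset_isCompact (isCompact_closedBall 0 1) hsupp
  set M := ContinuousLinearMap.mul ℝ ℂ with hM
  have hD := hc.hasFDerivAt_convolution_left M hf locallyIntegrable_complex_inv z
  have hex := (hc.fderiv ℝ).convolutionExists_left (M.precompL ℂ)
    (hf.continuous_fderiv one_ne_zero) locallyIntegrable_complex_inv z
  have hint : ∀ v, Integrable (fun t => fderiv ℝ f t v * (z - t)⁻¹) := fun v =>
    (ContinuousLinearMap.apply ℝ ℂ v).integrable_comp hex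
  have happ : ∀ v, (fderiv ℝ f ⋆[M.precompL ℂ] fun w : ℂ => w⁻¹) z v
      = ∫ t, fderiv ℝ f t v * (z - t)⁻¹ := by
    intro v
    rw [convolution_def, ContinuousLinearMap.integral_apply hex]
    rfl
  refine ⟨(Real.pi : ℂ)⁻¹ • (fderiv ℝ f ⋆[M.precompL ℂ] fun w : ℂ => w⁻¹) z, ?_, ?_⟩
  · rw [funext (cauchyTransform_eq_convolution hf.continuous hsupp)]
    exact hD.const_mul _
  · have hpi : (Real.pi : ℂ) ≠ 0 := by exact_mod_cast Real.pi_ne_zero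
    have key : (∫ t, fderiv ℝ f t 1 * (z - t)⁻¹) + I * ∫ t, fderiv ℝ f t I * (z - t)⁻¹
        = 2 * Real.pi * f z := by
      rw [← integral_const_mul, ← integral_add (hint 1) ((hint I).const_mul I),
        ← integral_add_left_eq_self _ z, ← neg_eq_iff_eq_neg.mpr (integral_dbar_mul_inv hf hc z),
        ← integral_neg]
      refine integral_congr_ae (Filter.Eventually.of_forall fun w => ?_)
      simp only [sub_add_cancel_left, inv_neg]
      ring
    simp only [smul_apply, happ, smul_eq_mul]
    rw [mul_left_comm I, ← mul_add, key]
    field_simp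
end

section
/- Let a > 0 and let f : ℝ → ℂ be continuous with compact support. Define u(s) = ∫_{−∞}^{s} e^{−a(s−t)}·f(t) dt. Then u is differentiable with u′(s) + a·u(s) = f(s) for all s ∈ ℝ, and for every real p with 1 ≤ p < ∞ one has (∫_ℝ |u(s)|^p ds)^{1/p} ≤ (1/a)·(∫_ℝ |f(t)|^p dt)^{1/p}. -/
open MeasureTheory

section Helpers

open ProbabilityTheory Set

/-- Jensen's inequality for the norm of a vector-valued integral. -/
lemma norm_integral_rpow_le {α E : Type*} [MeasurableSpace α] [NormedAddCommGroup E]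
    [NormedSpace ℝ E] {ν : Measure α} [IsProbabilityMeasure ν] {g : α → E} {p : ℝ} (hp : 1 ≤ p)
    (hg : Integrable g ν) (hgp : Integrable (fun x => ‖g x‖ ^ p) ν) :
    ‖∫ x, g x ∂ν‖ ^ p ≤ ∫ x, ‖g x‖ ^ p ∂ν := by
  refine (Real.rpow_le_rpow (norm_nonneg _) (norm_integral_le_integral_norm g)
    (by linarith)).trans ?_
  exact (convexOn_rpow hp).map_integral_le
    (Real.continuous_rpow_const (by linarith)).continuousOn isClosed_Ici
    (Filter.Eventually.of_forall fun x => norm_nonneg (g x)) hg.norm hgp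

lemma integrable_comp_sub_left_of_hasCompactSupport {E : Type*} [NormedAddCommGroup E]
    (ν : Measure ℝ) [IsFiniteMeasure ν] {h : ℝ → E} (hc : Continuous h)
    (hs : HasCompactSupport h) (s : ℝ) : Integrable (fun τ => h (s - τ)) ν := by
  obtain ⟨C, hC⟩ := hs.exists_bound_of_continuous hc
  have hm : Continuous fun τ => h (s - τ) := by fun_prop
  exact Integrable.of_bound hm.aestronglyMeasurable C (Filter.Eventually.of_forall fun τ => hC _)

/-- Averaging translates of a compactly supported function against a probability measure does not
increase the integral of the `p`-th power of the norm. -/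
lemma integral_norm_average_rpow_le {E : Type*} [NormedAddCommGroup E] [NormedSpace ℝ E]
    (ν : Measure ℝ) [IsProbabilityMeasure ν] {f : ℝ → E} (hf : Continuous f)
    (hsupp : HasCompactSupport f) {p : ℝ} (hp : 1 ≤ p) :
    ∫ s, ‖∫ τ, f (s - τ) ∂ν‖ ^ p ≤ ∫ t, ‖f t‖ ^ p := by
  have hp0 : 0 < p := by linarith
  set g : ℝ → ℝ := fun t => ‖f t‖ ^ p with hg
  have hgc : Continuous g := hf.norm.rpow_const fun _ => Or.inr hp0.le
  have hgs : HasCompactSupport g :=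
    hsupp.comp_left (g := fun x : E => ‖x‖ ^ p) (by simp [hp0.ne'])
  have hgi : Integrable g := hgc.integrable_of_hasCompactSupport hgs
  have hprod : Integrable (Function.uncurry fun s τ => g (s - τ)) (volume.prod ν) := by
    refine (integrable_prod_iff' ?_).2 ⟨Filter.Eventually.of_forall fun τ => ?_, ?_⟩
    · exact Continuous.aestronglyMeasurable (by fun_prop)
    · exact hgi.comp_sub_right τ
    · simp only [Function.uncurry_apply_pair]
      simp_rw [integral_sub_right_eq_self (fun t => ‖g t‖)]
      exact integrable_const _
  calc ∫ s, ‖∫ τ, f (s - τ) ∂ν‖ ^ p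
      ≤ ∫ s, ∫ τ, g (s - τ) ∂ν :=
        integral_mono_of_nonneg (Filter.Eventually.of_forall fun s => by positivity)
          hprod.integral_prod_left (Filter.Eventually.of_forall fun s =>
            norm_integral_rpow_le hp
              (integrable_comp_sub_left_of_hasCompactSupport ν hf hsupp s)
              (integrable_comp_sub_left_of_hasCompactSupport ν hgc hgs s))
    _ = ∫ τ, (∫ s, g (s - τ)) ∂ν := integral_integral_swap hprod
    _ = ∫ t, g t := by simp [integral_sub_right_eq_self g]

/-- The exponentially weighted integral over the past is an average of translates against the
exponential distribution. -/
lemma setIntegral_exp_mul_eq_expMeasure {a : ℝ} (ha : 0 < a) (f : ℝ → ℂ) (s : ℝ) :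
    ∫ t in Iic s, Complex.exp (-(a : ℂ) * ((s : ℂ) - (t : ℂ))) * f t =
      (1 / a : ℝ) • ∫ τ, f (s - τ) ∂(expMeasure a) := by
  have hpdf : expMeasure a = volume.withDensity (exponentialPDF a) := rfl
  have hmeas : Measurable (exponentialPDF a) :=
    (measurable_exponentialPDFReal a).ennreal_ofReal
  rw [hpdf, integral_withDensity_eq_integral_toReal_smul hmeas
    (Filter.Eventually.of_forall fun _ => ENNReal.ofReal_lt_top),
    ← integral_sub_left_eq_self _ volume s, ← integral_smul, ← integral_indicator measurableSet_Iic]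
  refine integral_congr_ae (Filter.Eventually.of_forall fun t => ?_)
  by_cases hts : t ≤ s
  · have : (a : ℂ) ≠ 0 := by exact_mod_cast ha.ne'
    have hnn : 0 ≤ a * Real.exp (-(a * (s - t))) := by positivity
    simp only [indicator_of_mem (show t ∈ Iic s from hts), exponentialPDF_eq,
      if_pos (sub_nonneg.2 hts), ENNReal.toReal_ofReal hnn, sub_sub_cancel, Complex.real_smul]
    push_cast
    field_simp
  · simp [exponentialPDF_eq, hts]

/-- Variation of constants: the exponentially weighted integral over the past solves
`u' + a u = f`. -/
lemma hasDerivAt_setIntegral_exp_mul (a : ℝ) {f : ℝ → ℂ} (hf : Continuous f)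
    (hsupp : HasCompactSupport f) (s : ℝ) :
    HasDerivAt (fun s' : ℝ =>
        ∫ t in Iic s', Complex.exp (-(a : ℂ) * ((s' : ℂ) - (t : ℂ))) * f t)
      (f s - (a : ℂ) * ∫ t in Iic s,
        Complex.exp (-(a : ℂ) * ((s : ℂ) - (t : ℂ))) * f t) s := by
  set g : ℝ → ℂ := fun t => Complex.exp (a * t) * f t with hg
  have hgc : Continuous g := by fun_prop
  have hgi : Integrable g := hgc.integrable_of_hasCompactSupport hsupp.mul_left
  have hfactor (s' : ℝ) : ∫ t in Iic s', Complex.exp (-(a : ℂ) * ((s' : ℂ) - (t : ℂ))) * f t =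
      Complex.exp (-(a : ℂ) * s') * ∫ t in Iic s', g t := by
    rw [← integral_const_mul]
    congr 1 with t
    rw [hg, ← mul_assoc, ← Complex.exp_add]
    ring_nf
  have hsplit (s' : ℝ) : ∫ t in Iic s', g t = (∫ t in Iic 0, g t) + ∫ t in (0 : ℝ)..s', g t := by
    rw [← intervalIntegral.integral_Iic_sub_Iic hgi.integrableOn hgi.integrableOn]
    ring
  have hG : HasDerivAt (fun s' : ℝ => ∫ t in Iic s', g t) (g s) s := by
    rw [funext hsplit]
    exact (intervalIntegral.integral_hasDerivAt_right (hgc.intervalIntegrable _ _)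
      (hgc.stronglyMeasurableAtFilter _ _) hgc.continuousAt).const_add _
  have hE : HasDerivAt (fun s' : ℝ => Complex.exp (-(a : ℂ) * s'))
      (Complex.exp (-(a : ℂ) * s) * -(a : ℂ)) s := by
    simpa using ((Complex.ofRealCLM.hasDerivAt (x := s)).const_mul (-(a : ℂ))).cexp
  simp_rw [hfactor]
  refine (hE.fun_mul hG).congr_deriv ?_
  have hcancel : Complex.exp (-(a : ℂ) * s) * g s = f s := by
    rw [hg, ← mul_assoc, ← Complex.exp_add]
    simp
  rw [hcancel]
  ring

end Helpers

/-- the convolution kernel `e^{−a(s−t)}·1_{t≤s}` gives a right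
inverse of `d/ds + a` with `L^p` operator norm at most `1/a`. -/
theorem stmt_15 (a : ℝ) (ha : 0 < a) (f : ℝ → ℂ)
    (hf : Continuous f) (hsupp : HasCompactSupport f) :
    (∀ s : ℝ,
      HasDerivAt (fun s' : ℝ =>
          ∫ t in Set.Iic s', Complex.exp (-(a : ℂ) * ((s' : ℂ) - (t : ℂ))) * f t)
        (f s - (a : ℂ) * ∫ t in Set.Iic s,
          Complex.exp (-(a : ℂ) * ((s : ℂ) - (t : ℂ))) * f t) s) ∧
    ∀ p : ℝ, 1 ≤ p →
      (∫ s : ℝ, ‖∫ t in Set.Iic s,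
          Complex.exp (-(a : ℂ) * ((s : ℂ) - (t : ℂ))) * f t‖ ^ p) ^ (1 / p) ≤
        (1 / a) * (∫ t : ℝ, ‖f t‖ ^ p) ^ (1 / p) := by
  refine ⟨hasDerivAt_setIntegral_exp_mul a hf hsupp, fun p hp => ?_⟩
  have hp0 : 0 < p := by linarith
  have : IsProbabilityMeasure (ProbabilityTheory.expMeasure a) :=
    ProbabilityTheory.isProbabilityMeasure_expMeasure ha
  have ha' : 0 ≤ 1 / a := by positivity
  simp_rw [setIntegral_exp_mul_eq_expMeasure ha f, norm_smul, Real.norm_of_nonneg ha',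
    Real.mul_rpow ha' (norm_nonneg _)]
  have hnn : 0 ≤ ∫ s, ‖∫ τ, f (s - τ) ∂(ProbabilityTheory.expMeasure a)‖ ^ p :=
    integral_nonneg fun s => by positivity
  rw [integral_const_mul, Real.mul_rpow (by positivity) hnn, ← Real.rpow_mul ha',
    mul_one_div_cancel hp0.ne', Real.rpow_one]
  refine mul_le_mul_of_nonneg_left (Real.rpow_le_rpow hnn ?_ (by positivity)) ha'
  exact integral_norm_average_rpow_le _ hf hsupp hp
end
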